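/- Let z : [0,T] → ℝⁿ be continuous and let (ξ, η) solve ξ'(t) = A_tξ(t) − B_tR_t⁻¹B_t^*η(t) + Ā_t z(t), ξ(0) = 0, −η'(t) = A_t^*η(t) + Q_tξ(t) + 𝒮_t z(t), η(T) = Q_Tξ(T) + 𝒮_T z(T). With ‖w‖_Q² = w(T)^*Q_T w(T) + ∫₀ᵀ w(t)^*Q_t w(t) dt, the following estimates hold: (a) for every t ∈ [0,T], ‖η(t)‖ ≤ ⦀φ⦀_T (‖ξ‖_Q + ⦀𝒮⦀_T ‖z‖_Q); and (b) ‖ξ‖_Q² ≤ √T · ⦀φ⦀_T (‖ξ‖_Q + ⦀𝒮⦀_T ‖z‖_Q) · ⦀Ā⦀_T · ‖z‖_Q + ‖ξ‖_Q · ⦀𝒮⦀_T · ‖z‖_Q. -/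

import Mathlib

open Matrix Set

noncomputable section

attribute [local instance] Matrix.normedAddCommGroup Matrix.normedSpace

/-- The operator (spectral) norm of a square real matrix. -/
def opN {k : ℕ} (M : Matrix (Fin k) (Fin k) ℝ) : ℝ :=
  ‖Matrix.toEuclideanCLM (𝕜 := ℝ) M‖

/-- `⦀φ⦀_T = sup_{0≤t≤T} (‖φ(T,t)^* Q_T^{1/2}‖² + ∫_t^T ‖φ(s,t)^* Q_s^{1/2}‖² ds)^{1/2}`,
where `Qh` (resp. `QTh`) is the positive square root of `Q` (resp. `Q_T`). -/
def phiNorm {n : ℕ} (T : ℝ) (φ : ℝ → ℝ → Matrix (Fin n) (Fin n) ℝ)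
    (Qh : ℝ → Matrix (Fin n) (Fin n) ℝ) (QTh : Matrix (Fin n) (Fin n) ℝ) : ℝ :=
  ⨆ t : Set.Icc (0:ℝ) T,
    Real.sqrt ((opN ((φ T t.1)ᵀ * QTh))^2 + ∫ s in t.1..T, (opN ((φ s t.1)ᵀ * Qh s))^2)

/-- `⦀Ā⦀_T = sup_{0<t<T} ‖Ā_t Q_t^{−1/2}‖`. -/
def abarNorm {n : ℕ} (T : ℝ) (Abar Qh : ℝ → Matrix (Fin n) (Fin n) ℝ) : ℝ :=
  ⨆ t : Set.Ioo (0:ℝ) T, opN (Abar t.1 * (Qh t.1)⁻¹)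

/-- `⦀𝒮⦀_T = sup_{0<t≤T} ‖Q_t^{−1/2} 𝒮_t Q_t^{−1/2}‖`, the terminal weights being
used at `t = T`. -/
def sNorm {n : ℕ} (T : ℝ) (S Qbar Qh : ℝ → Matrix (Fin n) (Fin n) ℝ)
    (ST QbarT QTh : Matrix (Fin n) (Fin n) ℝ) : ℝ :=
  max (⨆ t : Set.Ioo (0:ℝ) T,
        opN ((Qh t.1)⁻¹ * (Qbar t.1 * (1 - S t.1)) * (Qh t.1)⁻¹))
      (opN (QTh⁻¹ * (QbarT * (1 - ST)) * QTh⁻¹))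

/-- The weighted norm `‖w‖_Q = (w(T)ᵀ Q_T w(T) + ∫₀ᵀ w(t)ᵀ Q_t w(t) dt)^{1/2}`. -/
def qNorm {n : ℕ} (T : ℝ) (Q : ℝ → Matrix (Fin n) (Fin n) ℝ)
    (QT : Matrix (Fin n) (Fin n) ℝ) (w : ℝ → Fin n → ℝ) : ℝ :=
  Real.sqrt (w T ⬝ᵥ (QT *ᵥ w T) + ∫ t in (0:ℝ)..T, w t ⬝ᵥ ((Q t) *ᵥ w t))

lemma opN_nonneg {k : ℕ} (M : Matrix (Fin k) (Fin k) ℝ) : 0 ≤ opN M := norm_nonneg _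

lemma opN_mul_le {k : ℕ} (M N : Matrix (Fin k) (Fin k) ℝ) : opN (M * N) ≤ opN M * opN N := by
  unfold opN
  rw [map_mul]
  exact norm_mul_le _ _

lemma opN_transpose {k : ℕ} (M : Matrix (Fin k) (Fin k) ℝ) : opN Mᵀ = opN M := by
  unfold opN
  rw [← conjTranspose_eq_transpose_of_trivial, ← star_eq_conjTranspose, map_star]
  exact norm_star (E := EuclideanSpace ℝ (Fin k) →L[ℝ] EuclideanSpace ℝ (Fin k)) _

lemma opN_mul_transpose_self {k : ℕ} (M : Matrix (Fin k) (Fin k) ℝ) :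
    opN (M * Mᵀ) = opN M ^ 2 := by
  unfold opN
  rw [← conjTranspose_eq_transpose_of_trivial, ← star_eq_conjTranspose, map_mul, map_star, sq]
  exact CStarRing.norm_self_mul_star (E := EuclideanSpace ℝ (Fin k) →L[ℝ] EuclideanSpace ℝ (Fin k))

/-- `Matrix.toEuclideanCLM` as a continuous linear map. -/
def toEuclideanCLMₗ (k : ℕ) : Matrix (Fin k) (Fin k) ℝ →L[ℝ]
    (EuclideanSpace ℝ (Fin k) →L[ℝ] EuclideanSpace ℝ (Fin k)) :=
  LinearMap.toContinuousLinearMap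
    (Matrix.toEuclideanCLM (𝕜 := ℝ) (n := Fin k)).toAlgEquiv.toLinearMap

lemma continuous_opN {k : ℕ} : Continuous (opN (k := k)) :=
  (toEuclideanCLMₗ k).continuous.norm

lemma sqrt_dotProduct_self {k : ℕ} (v : Fin k → ℝ) : √(v ⬝ᵥ v) = ‖WithLp.toLp 2 v‖ := by
  rw [EuclideanSpace.norm_eq]
  simp [dotProduct, sq]

lemma dotProduct_le_sqrt_mul_sqrt {k : ℕ} (v w : Fin k → ℝ) :
    v ⬝ᵥ w ≤ √(v ⬝ᵥ v) * √(w ⬝ᵥ w) := by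
  rw [sqrt_dotProduct_self, sqrt_dotProduct_self]
  refine le_trans (le_of_eq ?_) (real_inner_le_norm (WithLp.toLp 2 v) (WithLp.toLp 2 w))
  simp [PiLp.inner_apply, dotProduct, mul_comm]

lemma sqrt_mulVec_dotProduct_self_le {k : ℕ} (M : Matrix (Fin k) (Fin k) ℝ) (v : Fin k → ℝ) :
    √((M *ᵥ v) ⬝ᵥ (M *ᵥ v)) ≤ opN M * √(v ⬝ᵥ v) := by
  rw [sqrt_dotProduct_self, sqrt_dotProduct_self]
  exact (Matrix.toEuclideanCLM (𝕜 := ℝ) M).le_opNorm (WithLp.toLp 2 v)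

lemma transpose_eq_self_of_posSemidef {k : ℕ} {K : Matrix (Fin k) (Fin k) ℝ}
    (hK : K.PosSemidef) : Kᵀ = K := by
  rw [← conjTranspose_eq_transpose_of_trivial]; exact hK.1

lemma isUnit_det_of_mul_self {k : ℕ} {K Q : Matrix (Fin k) (Fin k) ℝ} (hKQ : K * K = Q)
    (hQ : Q.PosDef) : IsUnit K.det := by
  have := hQ.det_pos
  rw [← hKQ, det_mul] at this
  exact isUnit_iff_ne_zero.mpr fun h => by simp [h] at this

lemma dotProduct_mulVec_self_eq {k : ℕ} {K Q : Matrix (Fin k) (Fin k) ℝ} (hK : K.PosSemidef)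
    (hKQ : K * K = Q) (u w : Fin k → ℝ) : u ⬝ᵥ (Q *ᵥ w) = (K *ᵥ u) ⬝ᵥ (K *ᵥ w) := by
  have hs := transpose_eq_self_of_posSemidef hK
  rw [← hKQ, ← mulVec_mulVec, dotProduct_mulVec, ← mulVec_transpose, hs]

lemma dotProduct_weight_le {k : ℕ} {K Q : Matrix (Fin k) (Fin k) ℝ} (hK : K.PosSemidef)
    (hKQ : K * K = Q) (u w : Fin k → ℝ) :
    u ⬝ᵥ (Q *ᵥ w) ≤ √(u ⬝ᵥ (Q *ᵥ u)) * √(w ⬝ᵥ (Q *ᵥ w)) := by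
  simp only [dotProduct_mulVec_self_eq hK hKQ]
  exact dotProduct_le_sqrt_mul_sqrt _ _

lemma sqrt_mulVec_le_weight {k : ℕ} {K Q : Matrix (Fin k) (Fin k) ℝ} (hK : K.PosSemidef)
    (hKQ : K * K = Q) (hQ : Q.PosDef) (N : Matrix (Fin k) (Fin k) ℝ) (w : Fin k → ℝ) :
    √((N *ᵥ w) ⬝ᵥ (N *ᵥ w)) ≤ opN (N * K⁻¹) * √(w ⬝ᵥ (Q *ᵥ w)) := by
  have hN : N *ᵥ w = (N * K⁻¹) *ᵥ (K *ᵥ w) := by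
    rw [mulVec_mulVec, Matrix.mul_assoc, Matrix.nonsing_inv_mul _ (isUnit_det_of_mul_self hKQ hQ),
      Matrix.mul_one]
  rw [hN, dotProduct_mulVec_self_eq hK hKQ]
  exact sqrt_mulVec_dotProduct_self_le _ _

/-- A bilinear form bounded relatively to the weight `Q = K²`. -/
lemma dotProduct_mulVec_le_weight {k : ℕ} {K Q : Matrix (Fin k) (Fin k) ℝ} (hK : K.PosSemidef)
    (hKQ : K * K = Q) (hQ : Q.PosDef) (N : Matrix (Fin k) (Fin k) ℝ) (u w : Fin k → ℝ) :
    u ⬝ᵥ (N *ᵥ w) ≤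
      opN (K⁻¹ * N * K⁻¹) * (√(u ⬝ᵥ (Q *ᵥ u)) * √(w ⬝ᵥ (Q *ᵥ w))) := by
  have hs := transpose_eq_self_of_posSemidef hK
  have hdet := isUnit_det_of_mul_self hKQ hQ
  have hN : N = K * ((K⁻¹ * N * K⁻¹) * K) := by
    rw [Matrix.mul_assoc, Matrix.nonsing_inv_mul _ hdet, Matrix.mul_one, ← Matrix.mul_assoc,
      Matrix.mul_nonsing_inv _ hdet, Matrix.one_mul]
  have h1 : u ⬝ᵥ (N *ᵥ w) = (K *ᵥ u) ⬝ᵥ ((K⁻¹ * N * K⁻¹) *ᵥ (K *ᵥ w)) := by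
    conv_lhs => rw [hN]
    rw [← mulVec_mulVec, dotProduct_mulVec, ← mulVec_transpose, hs, ← mulVec_mulVec]
  rw [h1]
  simp only [dotProduct_mulVec_self_eq hK hKQ]
  refine (dotProduct_le_sqrt_mul_sqrt _ _).trans ?_
  have := mul_le_mul_of_nonneg_left (sqrt_mulVec_dotProduct_self_le (K⁻¹ * N * K⁻¹) (K *ᵥ w))
    (Real.sqrt_nonneg ((K *ᵥ u) ⬝ᵥ (K *ᵥ u)))
  linarith

lemma sqrt_mulVec_weight_le {k : ℕ} {K Q : Matrix (Fin k) (Fin k) ℝ} (hK : K.PosSemidef)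
    (hKQ : K * K = Q) (F : Matrix (Fin k) (Fin k) ℝ) (v : Fin k → ℝ) :
    √((F *ᵥ v) ⬝ᵥ (Q *ᵥ (F *ᵥ v))) ≤ opN (Fᵀ * K) * √(v ⬝ᵥ v) := by
  have hs := transpose_eq_self_of_posSemidef hK
  rw [dotProduct_mulVec_self_eq hK hKQ, mulVec_mulVec, ← opN_transpose, transpose_mul, hs,
    transpose_transpose]
  exact sqrt_mulVec_dotProduct_self_le _ _

lemma opN_transpose_mul_sq {k : ℕ} {K Q : Matrix (Fin k) (Fin k) ℝ} (hK : K.PosSemidef)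
    (hKQ : K * K = Q) (F : Matrix (Fin k) (Fin k) ℝ) :
    opN (Fᵀ * K) ^ 2 = opN (Fᵀ * Q * F) := by
  have hs := transpose_eq_self_of_posSemidef hK
  rw [← opN_mul_transpose_self, transpose_mul, hs, transpose_transpose, ← hKQ]
  simp only [Matrix.mul_assoc]

/-- The Cauchy–Schwarz inequality for an integral plus a point mass. -/
lemma mul_add_integral_mul_le {a b p q : ℝ} (hab : a ≤ b) {f g : ℝ → ℝ}
    (hf : ContinuousOn f (Icc a b)) (hg : ContinuousOn g (Icc a b)) :
    p * q + ∫ s in a..b, f s * g s ≤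
      √(p ^ 2 + ∫ s in a..b, f s ^ 2) * √(q ^ 2 + ∫ s in a..b, g s ^ 2) := by
  have hi : ∀ h : ℝ → ℝ, ContinuousOn h (Icc a b) →
      IntervalIntegrable h MeasureTheory.volume a b := fun h hh =>
    hh.intervalIntegrable_of_Icc hab
  have hF : 0 ≤ p ^ 2 + ∫ s in a..b, f s ^ 2 :=
    add_nonneg (sq_nonneg _) (intervalIntegral.integral_nonneg hab fun _ _ => sq_nonneg _)
  have key : ∀ x : ℝ, 0 ≤ (p ^ 2 + ∫ s in a..b, f s ^ 2) * (x * x) +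
      (2 * (p * q + ∫ s in a..b, f s * g s)) * x + (q ^ 2 + ∫ s in a..b, g s ^ 2) := by
    intro x
    have h0 : 0 ≤ (p * x + q) ^ 2 + ∫ s in a..b, (f s * x + g s) ^ 2 :=
      add_nonneg (sq_nonneg _) (intervalIntegral.integral_nonneg hab fun _ _ => sq_nonneg _)
    have h1 : ∫ s in a..b, (f s * x + g s) ^ 2 = (∫ s in a..b, f s ^ 2) * (x * x) +
        (∫ s in a..b, f s * g s) * (2 * x) + ∫ s in a..b, g s ^ 2 := by
      rw [← intervalIntegral.integral_mul_const, ← intervalIntegral.integral_mul_const,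
        ← intervalIntegral.integral_add, ← intervalIntegral.integral_add]
      · congr 1; ext s; ring
      · exact hi _ (by fun_prop)
      · exact hi _ (by fun_prop)
      · exact hi _ (by fun_prop)
      · exact hi _ (by fun_prop)
    rw [h1] at h0
    linarith
  have hd := discrim_le_zero key
  unfold discrim at hd
  rw [← Real.sqrt_mul hF]
  exact Real.le_sqrt_of_sq_le (by linarith)

lemma HasDerivWithinAt.dotProduct_real {k : ℕ} {f g : ℝ → Fin k → ℝ} {f' g' : Fin k → ℝ}
    {s : Set ℝ} {t : ℝ} (hf : HasDerivWithinAt f f' s t) (hg : HasDerivWithinAt g g' s t) :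
    HasDerivWithinAt (fun τ => f τ ⬝ᵥ g τ) (f' ⬝ᵥ g t + f t ⬝ᵥ g') s t := by
  rw [hasDerivWithinAt_pi] at hf hg
  unfold dotProduct
  rw [← Finset.sum_add_distrib]
  exact HasDerivWithinAt.fun_sum fun i _ => (hf i).mul (hg i)

lemma HasDerivWithinAt.mulVec_const {k : ℕ} {F : ℝ → Matrix (Fin k) (Fin k) ℝ}
    {F' : Matrix (Fin k) (Fin k) ℝ} {s : Set ℝ} {t : ℝ} (hF : HasDerivWithinAt F F' s t)
    (v : Fin k → ℝ) : HasDerivWithinAt (fun τ => F τ *ᵥ v) (F' *ᵥ v) s t :=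
  ((LinearMap.toContinuousLinearMap
    ((Matrix.mulVecBilin ℝ ℝ).flip v : Matrix (Fin k) (Fin k) ℝ →ₗ[ℝ] Fin k → ℝ)).hasFDerivAt
      ).comp_hasDerivWithinAt t hF

/-- A linear flow has its operator norm bounded by Grönwall's exponential. -/
lemma opN_le_exp_of_hasDerivWithinAt {k : ℕ} {a b C : ℝ} {A F : ℝ → Matrix (Fin k) (Fin k) ℝ}
    (hF : ∀ t ∈ Icc a b, HasDerivWithinAt F (A t * F t) (Icc a b) t)
    (hA : ∀ t ∈ Icc a b, opN (A t) ≤ C) {t : ℝ} (ht : t ∈ Icc a b) :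
    opN (F t) ≤ opN (F a) * Real.exp (C * (t - a)) := by
  have hd : ∀ t ∈ Icc a b, HasDerivWithinAt (fun τ => toEuclideanCLMₗ k (F τ))
      (toEuclideanCLMₗ k (A t * F t)) (Icc a b) t := fun t ht =>
    (toEuclideanCLMₗ k).hasFDerivAt.comp_hasDerivWithinAt t (hF t ht)
  have := norm_le_gronwallBound_of_norm_deriv_right_le (δ := opN (F a)) (K := C) (ε := 0)
    (fun t ht => (hd t ht).continuousWithinAt)
    (fun t ht => (hd t (Ico_subset_Icc_self ht)).mono_of_mem_nhdsWithin
      (Icc_mem_nhdsGE_of_mem ht)) le_rfl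
    (fun t ht => by
      have h1 := opN_mul_le (A t) (F t)
      have h2 := mul_le_mul_of_nonneg_right (hA t (Ico_subset_Icc_self ht)) (opN_nonneg (F t))
      rw [add_zero]
      exact h1.trans h2) t ht
  rwa [gronwallBound_ε0] at this

/-- The supremum defining `phiNorm` is finite. -/
lemma bddAbove_range_phi {n : ℕ} {T : ℝ} {A Q Qh : ℝ → Matrix (Fin n) (Fin n) ℝ}
    {QTh : Matrix (Fin n) (Fin n) ℝ} {φ : ℝ → ℝ → Matrix (Fin n) (Fin n) ℝ}
    (hAc : ContinuousOn A (Icc 0 T)) (hQc : ContinuousOn Q (Icc 0 T))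
    (hQh : ∀ t ∈ Icc (0:ℝ) T, (Qh t).PosSemidef ∧ Qh t * Qh t = Q t)
    (hφ : ∀ s ∈ Icc (0:ℝ) T, φ s s = 1 ∧
      ∀ t ∈ Icc (0:ℝ) T,
        HasDerivWithinAt (fun τ => φ τ s) (A t * φ t s) (Icc (0:ℝ) T) t) :
    BddAbove (range fun t : Icc (0:ℝ) T =>
      √((opN ((φ T t.1)ᵀ * QTh)) ^ 2 + ∫ s in t.1..T, (opN ((φ s t.1)ᵀ * Qh s)) ^ 2)) := by
  obtain ⟨C, hC⟩ := isCompact_Icc.bddAbove_image (continuous_opN.comp_continuousOn hAc)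
  obtain ⟨D, hD⟩ := isCompact_Icc.bddAbove_image (continuous_opN.comp_continuousOn hQc)
  have hC' : ∀ t ∈ Icc (0:ℝ) T, opN (A t) ≤ C := fun t ht => hC ⟨t, ht, rfl⟩
  have hD' : ∀ t ∈ Icc (0:ℝ) T, opN (Q t) ≤ D := fun t ht => hD ⟨t, ht, rfl⟩
  set E := opN (1 : Matrix (Fin n) (Fin n) ℝ) * Real.exp (C * T) with hE
  have hE0 : 0 ≤ E := mul_nonneg (opN_nonneg _) (Real.exp_nonneg _)
  have hbd : ∀ t ∈ Icc (0:ℝ) T, ∀ s ∈ Icc t T, opN (φ s t) ≤ E := by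
    intro t ht s hs
    have hsub : Icc t T ⊆ Icc 0 T := Icc_subset_Icc_left ht.1
    have := opN_le_exp_of_hasDerivWithinAt (F := fun τ => φ τ t)
      (fun r hr => ((hφ t ht).2 r (hsub hr)).mono hsub) (fun r hr => hC' r (hsub hr)) hs
    simp only [(hφ t ht).1] at this
    refine this.trans (mul_le_mul_of_nonneg_left (Real.exp_le_exp.mpr ?_) (opN_nonneg _))
    have : 0 ≤ C := (opN_nonneg _).trans (hC' t ht)
    exact mul_le_mul_of_nonneg_left (by linarith [hs.2, ht.1]) this
  refine ⟨√((E * opN QTh) ^ 2 + E * D * E * T), ?_⟩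
  rintro _ ⟨⟨t, ht⟩, rfl⟩
  have hD0 : 0 ≤ D := (opN_nonneg _).trans (hD' t ht)
  refine Real.sqrt_le_sqrt (add_le_add ?_ ?_)
  · refine pow_le_pow_left₀ (opN_nonneg _) ((opN_mul_le _ _).trans ?_) 2
    rw [opN_transpose]
    exact mul_le_mul_of_nonneg_right (hbd t ht T ⟨ht.2, le_rfl⟩) (opN_nonneg _)
  · have h := intervalIntegral.norm_integral_le_of_norm_le_const (a := t) (b := T)
      (C := E * D * E) (f := fun s => (opN ((φ s t)ᵀ * Qh s)) ^ 2) (fun s hs => by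
        rw [uIoc_of_le ht.2] at hs
        have hs0 : s ∈ Icc 0 T := ⟨ht.1.trans hs.1.le, hs.2⟩
        rw [Real.norm_of_nonneg (sq_nonneg _), opN_transpose_mul_sq (hQh s hs0).1 (hQh s hs0).2]
        have h1 := hbd t ht s ⟨hs.1.le, hs.2⟩
        refine (opN_mul_le _ _).trans (mul_le_mul ((opN_mul_le _ _).trans ?_) h1
          (opN_nonneg _) (by positivity))
        rw [opN_transpose]
        exact mul_le_mul h1 (hD' s hs0) (opN_nonneg _) hE0)
    refine (le_abs_self _).trans (h.trans ?_)
    rw [abs_of_nonneg (by linarith [ht.2])]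
    exact mul_le_mul_of_nonneg_left (by linarith [ht.1]) (by positivity)

lemma continuousOn_sqrt_weight {n : ℕ} {s : Set ℝ} {Q : ℝ → Matrix (Fin n) (Fin n) ℝ}
    {w : ℝ → Fin n → ℝ} (hQ : ContinuousOn Q s) (hw : ContinuousOn w s) :
    ContinuousOn (fun t => √(w t ⬝ᵥ (Q t *ᵥ w t))) s := by
  rw [continuousOn_iff_continuous_domRestrict] at hQ hw ⊢
  exact (hw.dotProduct (hQ.matrix_mulVec hw)).sqrt

lemma continuousOn_opN_transpose_mul {n : ℕ} {s : Set ℝ} {F K Q : ℝ → Matrix (Fin n) (Fin n) ℝ}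
    (hF : ContinuousOn F s) (hQ : ContinuousOn Q s)
    (hK : ∀ t ∈ s, (K t).PosSemidef ∧ K t * K t = Q t) :
    ContinuousOn (fun t => opN ((F t)ᵀ * K t)) s := by
  have h : ContinuousOn (fun t => √(opN ((F t)ᵀ * Q t * F t))) s := by
    rw [continuousOn_iff_continuous_domRestrict] at hF hQ ⊢
    exact (continuous_opN.comp ((hF.matrix_transpose.matrix_mul hQ).matrix_mul hF)).sqrt
  refine h.congr fun t ht => ?_
  simp only [← opN_transpose_mul_sq (hK t ht).1 (hK t ht).2, Real.sqrt_sq (opN_nonneg _)]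

lemma qNorm_nonneg {n : ℕ} (T : ℝ) (Q : ℝ → Matrix (Fin n) (Fin n) ℝ)
    (QT : Matrix (Fin n) (Fin n) ℝ) (w : ℝ → Fin n → ℝ) : 0 ≤ qNorm T Q QT w :=
  Real.sqrt_nonneg _

lemma dotProduct_mulVec_self_nonneg {n : ℕ} {Q : Matrix (Fin n) (Fin n) ℝ} (hQ : Q.PosDef)
    (w : Fin n → ℝ) : 0 ≤ w ⬝ᵥ (Q *ᵥ w) := by
  simpa using hQ.posSemidef.dotProduct_mulVec_nonneg w

lemma qNorm_eq {n : ℕ} {T : ℝ} (hT : 0 ≤ T) {Q : ℝ → Matrix (Fin n) (Fin n) ℝ}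
    {QT : Matrix (Fin n) (Fin n) ℝ} (hQ : ∀ t ∈ Icc (0:ℝ) T, (Q t).PosDef) (hQT : QT.PosDef)
    (w : ℝ → Fin n → ℝ) :
    qNorm T Q QT w = √(√(w T ⬝ᵥ (QT *ᵥ w T)) ^ 2 +
      ∫ t in (0:ℝ)..T, √(w t ⬝ᵥ (Q t *ᵥ w t)) ^ 2) := by
  unfold qNorm
  rw [Real.sq_sqrt (dotProduct_mulVec_self_nonneg hQT _)]
  congr 2
  refine intervalIntegral.integral_congr fun t ht => ?_
  rw [uIcc_of_le hT] at ht
  exact (Real.sq_sqrt (dotProduct_mulVec_self_nonneg (hQ t ht) _)).symm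

lemma sqrt_weight_le_qNorm {n : ℕ} {T : ℝ} {Q : ℝ → Matrix (Fin n) (Fin n) ℝ}
    {QT : Matrix (Fin n) (Fin n) ℝ} (hQc : ContinuousOn Q (Icc 0 T))
    (hQ : ∀ t ∈ Icc (0:ℝ) T, (Q t).PosDef) (hQT : QT.PosDef)
    {w : ℝ → Fin n → ℝ} (hw : ContinuousOn w (Icc 0 T)) {t : ℝ} (ht : t ∈ Icc 0 T) :
    √(√(w T ⬝ᵥ (QT *ᵥ w T)) ^ 2 + ∫ s in t..T, √(w s ⬝ᵥ (Q s *ᵥ w s)) ^ 2) ≤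
      qNorm T Q QT w := by
  have hT : 0 ≤ T := ht.1.trans ht.2
  rw [qNorm_eq hT hQ hQT]
  refine Real.sqrt_le_sqrt (add_le_add le_rfl ?_)
  refine intervalIntegral.integral_mono_interval ht.1 ht.2 le_rfl
    (Filter.Eventually.of_forall fun _ => sq_nonneg _) ?_
  exact ((continuousOn_sqrt_weight hQc hw).pow 2).intervalIntegrable_of_Icc hT

/-- the estimates in the proof of Theorem 3.4: for a solution
`(ξ, η)` of the inhomogeneous forward–backward system with `ξ(0) = 0`, one has
(a) `‖η(t)‖ ≤ ⦀φ⦀_T (‖ξ‖_Q + ⦀𝒮⦀_T ‖z‖_Q)` for all `t ∈ [0,T]`, and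
(b) `‖ξ‖_Q² ≤ √T ⦀φ⦀_T (‖ξ‖_Q + ⦀𝒮⦀_T ‖z‖_Q) ⦀Ā⦀_T ‖z‖_Q + ‖ξ‖_Q ⦀𝒮⦀_T ‖z‖_Q`. -/
theorem eta_xi_estimates
    (n m : ℕ) (T : ℝ) (hT : 0 < T)
    (A Abar S Q Qbar : ℝ → Matrix (Fin n) (Fin n) ℝ)
    (B : ℝ → Matrix (Fin n) (Fin m) ℝ)
    (R : ℝ → Matrix (Fin m) (Fin m) ℝ)
    (QT QbarT ST : Matrix (Fin n) (Fin n) ℝ)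
    (hAc : ContinuousOn A (Set.Icc 0 T)) (hAbarc : ContinuousOn Abar (Set.Icc 0 T))
    (hBc : ContinuousOn B (Set.Icc 0 T)) (hSc : ContinuousOn S (Set.Icc 0 T))
    (hQc : ContinuousOn Q (Set.Icc 0 T)) (hQbarc : ContinuousOn Qbar (Set.Icc 0 T))
    (hRc : ContinuousOn R (Set.Icc 0 T))
    (hQ : ∀ t ∈ Set.Icc (0:ℝ) T, (Q t).PosDef)
    (hQbar : ∀ t ∈ Set.Icc (0:ℝ) T, (Qbar t).PosSemidef)
    (hR : ∀ t ∈ Set.Icc (0:ℝ) T, (R t).PosDef)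
    (hQT : QT.PosDef) (hQbarT : QbarT.PosSemidef)
    (Qh : ℝ → Matrix (Fin n) (Fin n) ℝ) (QTh : Matrix (Fin n) (Fin n) ℝ)
    (hQh : ∀ t ∈ Set.Icc (0:ℝ) T, (Qh t).PosSemidef ∧ Qh t * Qh t = Q t)
    (hQTh : QTh.PosSemidef ∧ QTh * QTh = QT)
    (φ : ℝ → ℝ → Matrix (Fin n) (Fin n) ℝ)
    (hφ : ∀ s ∈ Set.Icc (0:ℝ) T, φ s s = 1 ∧
      ∀ t ∈ Set.Icc (0:ℝ) T,
        HasDerivWithinAt (fun τ => φ τ s) (A t * φ t s) (Set.Icc (0:ℝ) T) t)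
    (hAbarFin : BddAbove (Set.range fun t : Set.Ioo (0:ℝ) T =>
        opN (Abar t.1 * (Qh t.1)⁻¹)))
    (hSFin : BddAbove (Set.range fun t : Set.Ioo (0:ℝ) T =>
        opN ((Qh t.1)⁻¹ * (Qbar t.1 * (1 - S t.1)) * (Qh t.1)⁻¹)))
    (z : ℝ → Fin n → ℝ) (hz : ContinuousOn z (Set.Icc 0 T))
    (ξ η : ℝ → Fin n → ℝ)
    (hξ : ∀ t ∈ Set.Icc (0:ℝ) T, HasDerivWithinAt ξ
        ((A t) *ᵥ ξ t - (B t * (R t)⁻¹ * (B t)ᵀ) *ᵥ η t + (Abar t) *ᵥ z t)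
        (Set.Icc (0:ℝ) T) t)
    (hξ0 : ξ 0 = 0)
    (hη : ∀ t ∈ Set.Icc (0:ℝ) T, HasDerivWithinAt η
        (-((A t)ᵀ *ᵥ η t + (Q t) *ᵥ ξ t + (Qbar t * (1 - S t)) *ᵥ z t))
        (Set.Icc (0:ℝ) T) t)
    (hηT : η T = QT *ᵥ ξ T + (QbarT * (1 - ST)) *ᵥ z T) :
    (∀ t ∈ Set.Icc (0:ℝ) T,
        Real.sqrt (η t ⬝ᵥ η t)
          ≤ phiNorm T φ Qh QTh
              * (qNorm T Q QT ξ + sNorm T S Qbar Qh ST QbarT QTh * qNorm T Q QT z)) ∧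
    (qNorm T Q QT ξ)^2
      ≤ Real.sqrt T * phiNorm T φ Qh QTh
          * (qNorm T Q QT ξ + sNorm T S Qbar Qh ST QbarT QTh * qNorm T Q QT z)
          * abarNorm T Abar Qh * qNorm T Q QT z
        + qNorm T Q QT ξ * sNorm T S Qbar Qh ST QbarT QTh * qNorm T Q QT z := by
  have hξc : ContinuousOn ξ (Icc 0 T) := fun t ht => (hξ t ht).continuousWithinAt
  have hηc : ContinuousOn η (Icc 0 T) := fun t ht => (hη t ht).continuousWithinAt
  set σ := sNorm T S Qbar Qh ST QbarT QTh with hσ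
  set Φ := phiNorm T φ Qh QTh with hΦ
  set α := abarNorm T Abar Qh with hα
  set X := qNorm T Q QT ξ with hX
  set Z := qNorm T Q QT z with hZ
  have hX0 : 0 ≤ X := qNorm_nonneg ..
  have hZ0 : 0 ≤ Z := qNorm_nonneg ..
  have hσT : opN (QTh⁻¹ * (QbarT * (1 - ST)) * QTh⁻¹) ≤ σ := le_max_right _ _
  have hσt : ∀ t ∈ Ioo (0:ℝ) T,
      opN ((Qh t)⁻¹ * (Qbar t * (1 - S t)) * (Qh t)⁻¹) ≤ σ := fun t ht =>
    (le_ciSup hSFin ⟨t, ht⟩).trans (le_max_left _ _)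
  have hαt : ∀ t ∈ Ioo (0:ℝ) T, opN (Abar t * (Qh t)⁻¹) ≤ α := fun t ht =>
    le_ciSup hAbarFin ⟨t, ht⟩
  have hσ0 : 0 ≤ σ := (opN_nonneg _).trans hσT
  have hα0 : 0 ≤ α := Real.iSup_nonneg fun _ => opN_nonneg _
  have hΦ0 : 0 ≤ Φ := Real.iSup_nonneg fun _ => Real.sqrt_nonneg _
  set x : ℝ → ℝ := fun s => √(ξ s ⬝ᵥ (Q s *ᵥ ξ s)) with hx
  set y : ℝ → ℝ := fun s => √(z s ⬝ᵥ (Q s *ᵥ z s)) with hy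
  set xT : ℝ := √(ξ T ⬝ᵥ (QT *ᵥ ξ T)) with hxT
  set yT : ℝ := √(z T ⬝ᵥ (QT *ᵥ z T)) with hyT
  have hxc : ContinuousOn x (Icc 0 T) := continuousOn_sqrt_weight hQc hξc
  have hyc : ContinuousOn y (Icc 0 T) := continuousOn_sqrt_weight hQc hz
  have hdT : ∀ (u w : Fin n → ℝ), u ⬝ᵥ ((QbarT * (1 - ST)) *ᵥ w) ≤
      σ * (√(u ⬝ᵥ (QT *ᵥ u)) * √(w ⬝ᵥ (QT *ᵥ w))) := fun u w =>
    (dotProduct_mulVec_le_weight hQTh.1 hQTh.2 hQT _ u w).trans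
      (mul_le_mul_of_nonneg_right hσT (by positivity))
  have hdt : ∀ t ∈ Ioo (0:ℝ) T, ∀ (u w : Fin n → ℝ), u ⬝ᵥ ((Qbar t * (1 - S t)) *ᵥ w) ≤
      σ * (√(u ⬝ᵥ (Q t *ᵥ u)) * √(w ⬝ᵥ (Q t *ᵥ w))) := fun t ht u w =>
    have ht' := Ioo_subset_Icc_self ht
    (dotProduct_mulVec_le_weight (hQh t ht').1 (hQh t ht').2 (hQ t ht') _ u w).trans
      (mul_le_mul_of_nonneg_right (hσt t ht) (by positivity))
  have ha : ∀ t ∈ Icc (0:ℝ) T, √(η t ⬝ᵥ η t) ≤ Φ * (X + σ * Z) := by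
    intro t ht
    have hsub : Icc t T ⊆ Icc 0 T := Icc_subset_Icc_left ht.1
    set v := η t with hv
    set N := √(v ⬝ᵥ v) with hN
    have hN0 : 0 ≤ N := Real.sqrt_nonneg _
    set a : ℝ → ℝ := fun s => opN ((φ s t)ᵀ * Qh s) with hadef
    set aT : ℝ := opN ((φ T t)ᵀ * QTh) with haT
    have hac : ContinuousOn a (Icc t T) := continuousOn_opN_transpose_mul
      (fun s hs => (((hφ t ht).2 s (hsub hs)).mono hsub).continuousWithinAt)
      (hQc.mono hsub) (fun s hs => hQh s (hsub hs))
    have hxc' := hxc.mono hsub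
    have hyc' := hyc.mono hsub
    have hderiv : ∀ s ∈ Icc t T, HasDerivWithinAt (fun τ => -((φ τ t *ᵥ v) ⬝ᵥ η τ))
        ((φ s t *ᵥ v) ⬝ᵥ (Q s *ᵥ ξ s) + (φ s t *ᵥ v) ⬝ᵥ ((Qbar s * (1 - S s)) *ᵥ z s))
        (Icc 0 T) s := by
      intro s hs
      refine ((((hφ t ht).2 s (hsub hs)).mulVec_const v).dotProduct_real
        (hη s (hsub hs))).fun_neg.congr_deriv ?_
      have h1 : (φ s t *ᵥ v) ⬝ᵥ ((A s)ᵀ *ᵥ η s) = ((A s * φ s t) *ᵥ v) ⬝ᵥ η s := by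
        rw [dotProduct_mulVec, vecMul_transpose, mulVec_mulVec]
      rw [dotProduct_neg, dotProduct_add, dotProduct_add, h1]
      ring
    have hint := intervalIntegral.sub_le_integral_of_hasDeriv_right_of_le ht.2
      (φ := fun s => N * (a s * x s + σ * (a s * y s)))
      (fun s hs => ((hderiv s hs).mono hsub).continuousWithinAt)
      (fun s hs => (hderiv s (Ioo_subset_Icc_self hs)).mono_of_mem_nhdsWithin
        (mem_nhdsWithin_of_mem_nhds (Icc_mem_nhds (ht.1.trans_lt hs.1) hs.2)))
      (ContinuousOn.integrableOn_Icc (by fun_prop))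
      (fun s hs => by
        have hs0 : s ∈ Ioo 0 T := ⟨ht.1.trans_lt hs.1, hs.2⟩
        obtain ⟨hK, hKQ⟩ := hQh s (Ioo_subset_Icc_self hs0)
        have h1 := dotProduct_weight_le hK hKQ (φ s t *ᵥ v) (ξ s)
        have h2 := hdt s hs0 (φ s t *ᵥ v) (z s)
        have h3 := sqrt_mulVec_weight_le hK hKQ (φ s t) v
        have h4 := mul_le_mul_of_nonneg_right h3 (Real.sqrt_nonneg (ξ s ⬝ᵥ (Q s *ᵥ ξ s)))
        have h5 := mul_le_mul_of_nonneg_left (mul_le_mul_of_nonneg_right h3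
          (Real.sqrt_nonneg (z s ⬝ᵥ (Q s *ᵥ z s)))) hσ0
        simp only [hx, hy, hadef, hN]
        linarith)
    have hsplit : ∫ s in t..T, N * (a s * x s + σ * (a s * y s)) =
        N * ((∫ s in t..T, a s * x s) + σ * ∫ s in t..T, a s * y s) := by
      rw [intervalIntegral.integral_const_mul, intervalIntegral.integral_add,
        intervalIntegral.integral_const_mul]
      · exact ContinuousOn.intervalIntegrable_of_Icc ht.2 (by fun_prop)
      · exact ContinuousOn.intervalIntegrable_of_Icc ht.2 (by fun_prop)
    have hterm : (φ T t *ᵥ v) ⬝ᵥ η T ≤ N * (aT * xT + σ * (aT * yT)) := by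
      obtain ⟨hK, hKQ⟩ := hQTh
      have h1 := dotProduct_weight_le hK hKQ (φ T t *ᵥ v) (ξ T)
      have h2 := hdT (φ T t *ᵥ v) (z T)
      have h3 := sqrt_mulVec_weight_le hK hKQ (φ T t) v
      have h4 := mul_le_mul_of_nonneg_right h3 (Real.sqrt_nonneg (ξ T ⬝ᵥ (QT *ᵥ ξ T)))
      have h5 := mul_le_mul_of_nonneg_left (mul_le_mul_of_nonneg_right h3
        (Real.sqrt_nonneg (z T ⬝ᵥ (QT *ᵥ z T)))) hσ0
      rw [hηT, dotProduct_add]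
      simp only [hxT, hyT, haT, hN]
      linarith
    have hNN : v ⬝ᵥ v = N * N := by
      rw [hN, Real.mul_self_sqrt]
      exact Finset.sum_nonneg fun i _ => mul_self_nonneg _
    have hstart : (φ t t *ᵥ v) ⬝ᵥ η t = N * N := by
      rw [(hφ t ht).1, one_mulVec, ← hv, hNN]
    rw [hsplit, hstart] at hint
    have hphi : √(aT ^ 2 + ∫ s in t..T, a s ^ 2) ≤ Φ :=
      le_ciSup (bddAbove_range_phi (QTh := QTh) hAc hQc hQh hφ) ⟨t, ht⟩
    have hcsx : aT * xT + ∫ s in t..T, a s * x s ≤ Φ * X :=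
      (mul_add_integral_mul_le ht.2 hac hxc').trans
        (mul_le_mul hphi (sqrt_weight_le_qNorm hQc hQ hQT hξc ht) (Real.sqrt_nonneg _) hΦ0)
    have hcsy : aT * yT + ∫ s in t..T, a s * y s ≤ Φ * Z :=
      (mul_add_integral_mul_le ht.2 hac hyc').trans
        (mul_le_mul hphi (sqrt_weight_le_qNorm hQc hQ hQT hz ht) (Real.sqrt_nonneg _) hΦ0)
    rcases hN0.eq_or_lt with h0 | hpos
    · rw [← h0]; positivity
    · refine le_of_mul_le_mul_left ?_ hpos
      have h1 := mul_le_mul_of_nonneg_left hcsx hN0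
      have h2 := mul_le_mul_of_nonneg_left (mul_le_mul_of_nonneg_left hcsy hσ0) hN0
      linarith
  refine ⟨ha, ?_⟩
  set E := Φ * (X + σ * Z) with hE
  have hE0 : 0 ≤ E := by positivity
  have hderiv : ∀ s ∈ Icc 0 T, HasDerivWithinAt (fun τ => ξ τ ⬝ᵥ η τ)
      (-((B s * (R s)⁻¹ * (B s)ᵀ) *ᵥ η s ⬝ᵥ η s) + (Abar s *ᵥ z s) ⬝ᵥ η s
        - ξ s ⬝ᵥ (Q s *ᵥ ξ s) - ξ s ⬝ᵥ ((Qbar s * (1 - S s)) *ᵥ z s)) (Icc 0 T) s := by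
    intro s hs
    refine ((hξ s hs).dotProduct_real (hη s hs)).congr_deriv ?_
    have h1 : ξ s ⬝ᵥ ((A s)ᵀ *ᵥ η s) = (A s *ᵥ ξ s) ⬝ᵥ η s := by
      rw [dotProduct_mulVec, vecMul_transpose]
    rw [dotProduct_neg, dotProduct_add, dotProduct_add, h1, add_dotProduct, sub_dotProduct]
    ring
  have hint := intervalIntegral.sub_le_integral_of_hasDeriv_right_of_le hT.le
    (φ := fun s => E * α * (1 * y s) - x s ^ 2 + σ * (x s * y s))
    (fun s hs => (hderiv s hs).continuousWithinAt)
    (fun s hs => (hderiv s (Ioo_subset_Icc_self hs)).mono_of_mem_nhdsWithin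
      (mem_nhdsWithin_of_mem_nhds (Icc_mem_nhds hs.1 hs.2)))
    (ContinuousOn.integrableOn_Icc (by fun_prop))
    (fun s hs => by
      have hs0 := Ioo_subset_Icc_self hs
      have h1 : 0 ≤ (B s * (R s)⁻¹ * (B s)ᵀ) *ᵥ η s ⬝ᵥ η s := by
        have h := dotProduct_mulVec_self_nonneg (hR s hs0).inv ((B s)ᵀ *ᵥ η s)
        rw [dotProduct_comm, Matrix.mul_assoc, ← mulVec_mulVec, dotProduct_mulVec,
          ← mulVec_transpose, ← mulVec_mulVec]
        exact h
      have h2 : (Abar s *ᵥ z s) ⬝ᵥ η s ≤ E * α * (1 * y s) := by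
        refine (dotProduct_le_sqrt_mul_sqrt _ _).trans ?_
        have h3 := (sqrt_mulVec_le_weight (hQh s hs0).1 (hQh s hs0).2 (hQ s hs0) (Abar s)
          (z s)).trans (mul_le_mul_of_nonneg_right (hαt s hs) (Real.sqrt_nonneg _))
        refine (mul_le_mul h3 (ha s hs0) (Real.sqrt_nonneg _) (by positivity)).trans_eq ?_
        simp only [hy]
        ring
      have h4 : x s ^ 2 = ξ s ⬝ᵥ (Q s *ᵥ ξ s) :=
        Real.sq_sqrt (dotProduct_mulVec_self_nonneg (hQ s hs0) _)
      have h5 := hdt s hs (-ξ s) (z s)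
      simp only [neg_dotProduct, mulVec_neg, dotProduct_neg, neg_neg] at h5
      rw [h4]
      simp only [hx, hy] at h2 ⊢
      linarith)
  have hsplit : ∫ s in (0:ℝ)..T, (E * α * (1 * y s) - x s ^ 2 + σ * (x s * y s)) =
      E * α * (∫ s in (0:ℝ)..T, 1 * y s) - (∫ s in (0:ℝ)..T, x s ^ 2)
        + σ * ∫ s in (0:ℝ)..T, x s * y s := by
    rw [intervalIntegral.integral_add, intervalIntegral.integral_sub,
      intervalIntegral.integral_const_mul (E * α), intervalIntegral.integral_const_mul σ]
    all_goals exact ContinuousOn.intervalIntegrable_of_Icc hT.le (by fun_prop)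
  have h0 : ξ 0 ⬝ᵥ η 0 = 0 := by rw [hξ0, zero_dotProduct]
  have hXsq : X ^ 2 = xT ^ 2 + ∫ s in (0:ℝ)..T, x s ^ 2 := by
    rw [hX, qNorm_eq hT.le hQ hQT, Real.sq_sqrt]
    exact add_nonneg (sq_nonneg _) (intervalIntegral.integral_nonneg hT.le fun _ _ => sq_nonneg _)
  have hxTsq : xT ^ 2 = ξ T ⬝ᵥ (QT *ᵥ ξ T) :=
    Real.sq_sqrt (dotProduct_mulVec_self_nonneg hQT _)
  have hterm := hdT (-ξ T) (z T)
  simp only [neg_dotProduct, mulVec_neg, dotProduct_neg, neg_neg] at hterm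
  rw [hsplit, h0, hηT, dotProduct_add, ← hxTsq] at hint
  have hcs : xT * yT + ∫ s in (0:ℝ)..T, x s * y s ≤ X * Z := by
    rw [hX, hZ, qNorm_eq hT.le hQ hQT ξ, qNorm_eq hT.le hQ hQT z]
    exact mul_add_integral_mul_le hT.le hxc hyc
  have hy1 : ∫ s in (0:ℝ)..T, 1 * y s ≤ √T * Z := by
    have h := mul_add_integral_mul_le (p := 0) (q := yT) hT.le
      (continuousOn_const (c := (1:ℝ))) hyc
    rw [hZ, qNorm_eq hT.le hQ hQT z]
    simpa using h
  have h1 := mul_le_mul_of_nonneg_left hy1 (mul_nonneg hE0 hα0)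
  have h2 := mul_le_mul_of_nonneg_left hcs hσ0
  have h3 : √T * Φ * (X + σ * Z) * α * Z = E * α * (√T * Z) := by rw [hE]; ring
  rw [h3, hXsq]
  linarith

end
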